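/- Let n_1,…,n_m ∈ ℝ^n, let Δ = Δ(k⁰) be a Delzant polytope with n+1 ≤ m ≤ n+2 facets, and let b ∈ ℤ^n. Define f : C_Δ → ℝ by f(k) = ⟨Cm(Δ(k)), b⟩ and assume f is continuously differentiable on C_Δ. If ∑_{j=1}^m ∂f/∂k_j (k) = 0 for every k ∈ C_Δ, then there exist constants R_1,…,R_m ∈ ℝ such that f(k) = ∑_{j=1}^m R_j k_j for all k ∈ C_Δ (so (Δ, b) is a mass linear pair) and ∑_{j=1}^m R_j = 0. -/

import Mathlib

open MeasureTheory

noncomputable section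

/-- Euclidean inner product on ℝⁿ. -/
def dot {n : ℕ} (x y : Fin n → ℝ) : ℝ := ∑ i, x i * y i

/-- The polytope `Δ(k) = ⋂_j {x : ⟨x, n_j⟩ ≤ k_j}` determined by conormals `N` and
support numbers `k`. -/
def PolyDelta {n m : ℕ} (N : Fin m → Fin n → ℝ) (k : Fin m → ℝ) : Set (Fin n → ℝ) :=
  {x | ∀ j, dot x (N j) ≤ k j}

/-- The facet `F_j(k) = Δ(k) ∩ {x : ⟨x, n_j⟩ = k_j}`. -/
def PolyFacet {n m : ℕ} (N : Fin m → Fin n → ℝ) (k : Fin m → ℝ) (j : Fin m) :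
    Set (Fin n → ℝ) :=
  {x ∈ PolyDelta N k | dot x (N j) = k j}

/-- The chamber of the polytope `Δ(k⁰)`: those `k` for which the combinatorics of the
facets of `Δ(k)` agrees with that of `Δ(k⁰)`. -/
def chamber {n m : ℕ} (N : Fin m → Fin n → ℝ) (k0 : Fin m → ℝ) : Set (Fin m → ℝ) :=
  {k | ∀ J : Finset (Fin m),
    (⋂ j ∈ J, PolyFacet N k j).Nonempty ↔ (⋂ j ∈ J, PolyFacet N k0 j).Nonempty}

/-- Center of mass of a subset of ℝⁿ: `Cm(K) = (∫_K x dx)/(∫_K 1 dx)`. -/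
def Cm {n : ℕ} (K : Set (Fin n → ℝ)) : Fin n → ℝ :=
  (∫ x in K, (1 : ℝ))⁻¹ • ∫ x in K, x

/-- `(Δ(k⁰), b)` is a mass linear pair: `⟨Cm(Δ(k)), b⟩` is an (affine) linear function of
`k` on the chamber of `Δ(k⁰)`. -/
def IsMassLinear {n m : ℕ} (N : Fin m → Fin n → ℝ) (k0 : Fin m → ℝ) (b : Fin n → ℝ) :
    Prop :=
  ∃ (R : Fin m → ℝ) (C : ℝ), ∀ k ∈ chamber N k0,
    dot (Cm (PolyDelta N k)) b = (∑ j, R j * k j) + C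

/-- `Δ(k)` is a Delzant polytope: each conormal is a primitive integer vector, exactly `n`
facets meet at each vertex, and the conormals of the facets through any vertex form a
ℤ-basis of ℤⁿ (an integer matrix of determinant ±1). -/
def IsDelzant {n m : ℕ} (N : Fin m → Fin n → ℝ) (k : Fin m → ℝ) : Prop :=
  (∀ j, ∃ z : Fin n → ℤ, (∀ i, N j i = (z i : ℝ)) ∧ Finset.univ.gcd z = 1) ∧
  ∀ v ∈ Set.extremePoints ℝ (PolyDelta N k),
    ∃ J : Finset (Fin m), J.card = n ∧ (∀ j, j ∈ J ↔ dot v (N j) = k j) ∧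
      ∃ e : Fin n → Fin m, (∀ i, e i ∈ J) ∧ Function.Injective e ∧
        |(Matrix.of fun i i' => N (e i) i').det| = 1

lemma dot_add_left {n : ℕ} (x y z : Fin n → ℝ) : dot (x + y) z = dot x z + dot y z := by
  simp [dot, add_mul, Finset.sum_add_distrib]

lemma dot_smul_left {n : ℕ} (t : ℝ) (x z : Fin n → ℝ) : dot (t • x) z = t * dot x z := by
  simp [dot, Finset.mul_sum, mul_assoc]

lemma dot_comm' {n : ℕ} (x z : Fin n → ℝ) : dot x z = dot z x := by
  simp [dot, mul_comm]

lemma dot_sum_right {n : ℕ} {ι : Type*} (s : Finset ι) (x : Fin n → ℝ) (g : ι → Fin n → ℝ) :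
    dot x (∑ i ∈ s, g i) = ∑ i ∈ s, dot x (g i) := by
  simp only [dot, Finset.sum_apply, Finset.mul_sum]
  rw [Finset.sum_comm]

lemma dot_smul_right {n : ℕ} (t : ℝ) (x z : Fin n → ℝ) : dot x (t • z) = t * dot x z := by
  rw [dot_comm', dot_smul_left, dot_comm']

/-- linear functional x ↦ dot x c -/
def dotL {n : ℕ} (c : Fin n → ℝ) : (Fin n → ℝ) →ₗ[ℝ] ℝ where
  toFun x := dot x c
  map_add' x y := dot_add_left x y c
  map_smul' t x := by simp [dot_smul_left]

lemma dot_cont {n : ℕ} (c : Fin n → ℝ) : Continuous (fun x : Fin n → ℝ => dot x c) := by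
  unfold dot; fun_prop

def vmat {n m : ℕ} (N : Fin m → Fin n → ℝ) (e : Fin n → Fin m) : Matrix (Fin n) (Fin n) ℝ :=
  Matrix.of fun i i' => N (e i) i'

lemma vmat_mulVec {n m : ℕ} (N : Fin m → Fin n → ℝ) (e : Fin n → Fin m) (x : Fin n → ℝ)
    (i : Fin n) : (vmat N e).mulVec x i = dot x (N (e i)) := by
  simp [vmat, Matrix.mulVec, dotProduct, dot, mul_comm]

def vtx {n m : ℕ} (N : Fin m → Fin n → ℝ) (e : Fin n → Fin m) (k : Fin m → ℝ) : Fin n → ℝ :=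
  (vmat N e)⁻¹.mulVec (fun i => k (e i))

/-- vertex index maps -/
def IsV {n m : ℕ} (N : Fin m → Fin n → ℝ) (k0 : Fin m → ℝ) (e : Fin n → Fin m) : Prop :=
  Function.Injective e ∧ IsUnit (vmat N e).det ∧
    ∃ v ∈ PolyDelta N k0, ∀ j, dot v (N j) = k0 j ↔ j ∈ Set.range e

lemma dot_vtx {n m : ℕ} (N : Fin m → Fin n → ℝ) (e : Fin n → Fin m) (k : Fin m → ℝ)
    (h : IsUnit (vmat N e).det) (i : Fin n) : dot (vtx N e k) (N (e i)) = k (e i) := by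
  rw [← vmat_mulVec, vtx, Matrix.mulVec_mulVec, Matrix.mul_nonsing_inv _ h, Matrix.one_mulVec]

lemma eq_vtx {n m : ℕ} (N : Fin m → Fin n → ℝ) (e : Fin n → Fin m) (k : Fin m → ℝ)
    (h : IsUnit (vmat N e).det) (x : Fin n → ℝ) (hx : ∀ i, dot x (N (e i)) = k (e i)) :
    x = vtx N e k := by
  have : (vmat N e).mulVec x = fun i => k (e i) := by
    ext i; rw [vmat_mulVec, hx]
  rw [vtx, ← this, Matrix.mulVec_mulVec, Matrix.nonsing_inv_mul _ h, Matrix.one_mulVec]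

lemma vtx_cont {n m : ℕ} (N : Fin m → Fin n → ℝ) (e : Fin n → Fin m) :
    Continuous (vtx N e) := by
  unfold vtx
  refine Continuous.matrix_mulVec continuous_const ?_
  fun_prop

lemma vtx_add {n m : ℕ} (N : Fin m → Fin n → ℝ) (e : Fin n → Fin m) (k k' : Fin m → ℝ) :
    vtx N e (k + k') = vtx N e k + vtx N e k' := by
  unfold vtx
  rw [← Matrix.mulVec_add]; rfl

lemma vtx_smul {n m : ℕ} (N : Fin m → Fin n → ℝ) (e : Fin n → Fin m) (t : ℝ) (k : Fin m → ℝ) :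
    vtx N e (t • k) = t • vtx N e k := by
  unfold vtx
  rw [← Matrix.mulVec_smul]; rfl

def UU {n m : ℕ} (N : Fin m → Fin n → ℝ) (k0 : Fin m → ℝ) : Set (Fin m → ℝ) :=
  {k | ∀ e, IsV N k0 e → ∀ j, j ∉ Set.range e → dot (vtx N e k) (N j) < k j}

lemma UU_open {n m : ℕ} (N : Fin m → Fin n → ℝ) (k0 : Fin m → ℝ) : IsOpen (UU N k0) := by
  have : UU N k0 = ⋂ e, ⋂ (_ : IsV N k0 e), ⋂ j, ⋂ (_ : j ∉ Set.range e),
      {k | dot (vtx N e k) (N j) < k j} := by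
    ext k; simp [UU]
  rw [this]
  refine isOpen_iInter_of_finite fun e => isOpen_iInter_of_finite fun _ =>
    isOpen_iInter_of_finite fun j => isOpen_iInter_of_finite fun _ => ?_
  exact isOpen_lt ((dot_cont (N j)).comp (vtx_cont N e)) (continuous_apply j)

lemma UU_convex {n m : ℕ} (N : Fin m → Fin n → ℝ) (k0 : Fin m → ℝ) : Convex ℝ (UU N k0) := by
  intro x hx y hy a b ha hb hab e he j hj
  have h1 := hx e he j hj
  have h2 := hy e he j hj
  rw [vtx_add, vtx_smul, vtx_smul, dot_add_left, dot_smul_left, dot_smul_left]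
  simp only [Pi.add_apply, Pi.smul_apply, smul_eq_mul]
  rcases ha.eq_or_lt with rfl | ha
  · have : b = 1 := by linarith
    subst this; linarith
  · nlinarith [mul_lt_mul_of_pos_left h1 ha, mul_le_mul_of_nonneg_left h2.le hb]

lemma k0_mem_UU {n m : ℕ} (N : Fin m → Fin n → ℝ) (k0 : Fin m → ℝ) : k0 ∈ UU N k0 := by
  rintro e ⟨-, hd, v, hv, hvt⟩ j hj
  have : v = vtx N e k0 := eq_vtx N e k0 hd v (fun i => (hvt _).2 ⟨i, rfl⟩)
  rw [← this]
  exact lt_of_le_of_ne (hv j) (fun h => hj ((hvt j).1 h))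

lemma vtx_mem {n m : ℕ} {N : Fin m → Fin n → ℝ} {k0 k : Fin m → ℝ} (hk : k ∈ UU N k0)
    {e : Fin n → Fin m} (he : IsV N k0 e) : vtx N e k ∈ PolyDelta N k := by
  intro j
  by_cases hj : j ∈ Set.range e
  · obtain ⟨i, rfl⟩ := hj
    exact (dot_vtx N e k he.2.1 i).le
  · exact (hk e he j hj).le

/-- normal cones cover -/
lemma cover {n m : ℕ} (N : Fin m → Fin n → ℝ) (k0 : Fin m → ℝ)
    (hcpt : IsCompact (PolyDelta N k0)) (hne : (PolyDelta N k0).Nonempty)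
    (hD : IsDelzant N k0) (c : Fin n → ℝ) :
    ∃ e, IsV N k0 e ∧ ∃ l : Fin n → ℝ, (∀ i, 0 ≤ l i) ∧ c = ∑ i, l i • N (e i) := by
  let L : StrongDual ℝ (Fin n → ℝ) := LinearMap.toContinuousLinearMap (dotL c)
  have hL : ∀ x, L x = dot x c := fun x => rfl
  have hexp : IsExposed ℝ (PolyDelta N k0) (L.toExposed (PolyDelta N k0)) :=
    ContinuousLinearMap.toExposed.isExposed
  obtain ⟨x0, hx0, hmax⟩ := hcpt.exists_isMaxOn hne L.continuous.continuousOn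
  have hne' : (L.toExposed (PolyDelta N k0)).Nonempty := ⟨x0, hx0, fun y hy => hmax hy⟩
  obtain ⟨v, hv⟩ := (hexp.isCompact hcpt).extremePoints_nonempty hne'
  have hvm : v ∈ L.toExposed (PolyDelta N k0) := hv.1
  have hve : v ∈ Set.extremePoints ℝ (PolyDelta N k0) :=
    hexp.isExtreme.extremePoints_subset_extremePoints hv
  obtain ⟨J, hJc, hJ, e, heJ, hei, hdet⟩ := hD.2 v hve
  have hdet' : IsUnit (vmat N e).det := by
    rw [isUnit_iff_ne_zero]; intro h
    change |(vmat N e).det| = 1 at hdet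
    rw [h] at hdet; simp at hdet
  have himg : Finset.univ.image e = J := by
    apply Finset.eq_of_subset_of_card_le
    · intro j hj; simp at hj; obtain ⟨i, rfl⟩ := hj; exact heJ i
    · rw [Finset.card_image_of_injective _ hei, hJc]; simp
  have htight : ∀ j, dot v (N j) = k0 j ↔ j ∈ Set.range e := by
    intro j; rw [← hJ, ← himg]; simp
  refine ⟨e, ⟨hei, hdet', v, hvm.1, htight⟩, Matrix.vecMul c (vmat N e)⁻¹, ?_, ?_⟩
  · intro i
    set d : Fin n → ℝ := (vmat N e)⁻¹.mulVec (Pi.single i (-1)) with hd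
    have hdN : ∀ i', dot d (N (e i')) = (Pi.single i (-1) : Fin n → ℝ) i' := by
      intro i'
      rw [← vmat_mulVec, hd, Matrix.mulVec_mulVec, Matrix.mul_nonsing_inv _ hdet',
        Matrix.one_mulVec]
    have hdc : dot d c = - Matrix.vecMul c (vmat N e)⁻¹ i := by
      have : dot d c = dotProduct c d := by simp [dot, dotProduct, mul_comm]
      rw [this, hd, Matrix.dotProduct_mulVec]
      simp
    -- small step stays inside
    have hev : ∀ᶠ t : ℝ in nhdsWithin 0 (Set.Ioi 0), v + t • d ∈ PolyDelta N k0 := by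
      have : ∀ j, ∀ᶠ t : ℝ in nhdsWithin 0 (Set.Ioi 0), dot (v + t • d) (N j) ≤ k0 j := by
        intro j
        by_cases hj : j ∈ Set.range e
        · filter_upwards [self_mem_nhdsWithin] with t ht
          have ht : 0 < t := ht
          have h0 := (htight j).2 hj
          obtain ⟨i', rfl⟩ := hj
          rw [dot_add_left, dot_smul_left, h0, hdN]
          by_cases hi : i' = i
          · subst hi; simp; exact ht.le
          · simp [Pi.single_apply, hi]
        · have hlt : dot v (N j) < k0 j :=
            lt_of_le_of_ne (hvm.1 j) (fun h => hj ((htight j).1 h))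
          have hc : Continuous (fun t : ℝ => dot (v + t • d) (N j)) :=
            (dot_cont (N j)).comp (by fun_prop)
          have h0 : dot (v + (0:ℝ) • d) (N j) < k0 j := by simpa using hlt
          have := (hc.tendsto 0).eventually (gt_mem_nhds h0)
          exact (this.filter_mono nhdsWithin_le_nhds).mono (fun t ht => ht.le)
      exact Filter.eventually_all.2 this
    obtain ⟨t, ht, htp⟩ := (hev.and self_mem_nhdsWithin).exists
    have htp : 0 < t := htp
    have h1 := hvm.2 _ ht
    rw [hL, hL, dot_add_left, dot_smul_left, hdc] at h1
    by_contra hneg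
    push Not at hneg
    nlinarith
  · have : Matrix.vecMul (Matrix.vecMul c (vmat N e)⁻¹) (vmat N e) = c := by
      rw [Matrix.vecMul_vecMul, Matrix.nonsing_inv_mul _ hdet', Matrix.vecMul_one]
    conv_lhs => rw [← this]
    ext j
    simp [Matrix.vecMul, dotProduct, vmat]

lemma inter_iff {n m : ℕ} (N : Fin m → Fin n → ℝ) (k0 : Fin m → ℝ)
    (hcpt : IsCompact (PolyDelta N k0)) (hne : (PolyDelta N k0).Nonempty)
    (hD : IsDelzant N k0) (k : Fin m → ℝ) (hk : k ∈ UU N k0) (J : Finset (Fin m))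
    (hJ : J.Nonempty) :
    (⋂ j ∈ J, PolyFacet N k j).Nonempty ↔ ∃ e, IsV N k0 e ∧ ∀ j ∈ J, j ∈ Set.range e := by
  constructor
  · rintro ⟨x, hx⟩
    simp only [Set.mem_iInter] at hx
    obtain ⟨j0, hj0⟩ := hJ
    have hxD : x ∈ PolyDelta N k := (hx j0 hj0).1
    obtain ⟨e, he, l, hl, hc⟩ := cover N k0 hcpt hne hD (∑ j ∈ J, N j)
    refine ⟨e, he, ?_⟩
    set w := vtx N e k with hw
    have hwD : w ∈ PolyDelta N k := vtx_mem hk he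
    have h1 : dot x (∑ j ∈ J, N j) = ∑ j ∈ J, k j := by
      rw [dot_sum_right]; exact Finset.sum_congr rfl fun j hj => (hx j hj).2
    have h2 : dot x (∑ j ∈ J, N j) ≤ dot w (∑ j ∈ J, N j) := by
      rw [hc, dot_sum_right, dot_sum_right]
      refine Finset.sum_le_sum fun i _ => ?_
      rw [dot_smul_right, dot_smul_right, dot_vtx N e k he.2.1]
      exact mul_le_mul_of_nonneg_left (hxD _) (hl i)
    rw [h1, dot_sum_right] at h2
    have h3 : ∀ j ∈ J, dot w (N j) ≤ k j := fun j _ => hwD j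
    have h4 := (Finset.sum_eq_sum_iff_of_le h3).1 (le_antisymm (Finset.sum_le_sum h3) h2)
    intro j hj
    by_contra hcon
    exact (hk e he j hcon).ne (h4 j hj)
  · rintro ⟨e, he, h⟩
    refine ⟨vtx N e k, ?_⟩
    simp only [Set.mem_iInter]
    intro j hj
    refine ⟨vtx_mem hk he, ?_⟩
    obtain ⟨i, rfl⟩ := h j hj
    exact dot_vtx N e k he.2.1 i

lemma chamber_eq {n m : ℕ} (N : Fin m → Fin n → ℝ) (k0 : Fin m → ℝ)
    (hcpt : IsCompact (PolyDelta N k0)) (hne : (PolyDelta N k0).Nonempty)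
    (hD : IsDelzant N k0) (hn : 0 < n) : chamber N k0 = UU N k0 := by
  have hk0 := k0_mem_UU N k0
  ext k
  constructor
  · intro hk e he j hj
    have h1 := (hk (Finset.univ.image e)).2 ((inter_iff N k0 hcpt hne hD k0 hk0 _
      ⟨e ⟨0, hn⟩, by simp⟩).2 ⟨e, he, by simp⟩)
    obtain ⟨w, hw⟩ := h1
    simp only [Set.mem_iInter] at hw
    have hw' : ∀ i, w ∈ PolyFacet N k (e i) := fun i => hw (e i) (by simp)
    have hwe : w = vtx N e k := eq_vtx N e k he.2.1 w (fun i => (hw' i).2)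
    rw [← hwe]
    have hwD : w ∈ PolyDelta N k := (hw' ⟨0, hn⟩).1
    refine lt_of_le_of_ne (hwD j) fun heq => ?_
    have h2 := (hk (insert j (Finset.univ.image e))).1 ⟨w, by
      simp only [Set.mem_iInter]
      intro j' hj'
      rcases Finset.mem_insert.1 hj' with rfl | hj'
      · exact ⟨hwD, heq⟩
      · exact hw j' hj'⟩
    obtain ⟨e', he', hsub⟩ := (inter_iff N k0 hcpt hne hD k0 hk0 _ (by simp)).1 h2
    have hs : insert j (Finset.univ.image e) ⊆ Finset.univ.image e' := by
      intro a ha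
      have := hsub a ha
      simpa using this
    have hc := Finset.card_le_card hs
    rw [Finset.card_insert_of_notMem (by simpa using hj),
      Finset.card_image_of_injective _ he.1, Finset.card_image_of_injective _ he'.1] at hc
    omega
  · intro hk J
    rcases J.eq_empty_or_nonempty with rfl | hJ
    · simp
    · rw [inter_iff N k0 hcpt hne hD k hk J hJ, inter_iff N k0 hcpt hne hD k0 hk0 J hJ]

lemma poly_closed {n m : ℕ} (N : Fin m → Fin n → ℝ) (k : Fin m → ℝ) :
    IsClosed (PolyDelta N k) := by
  have : PolyDelta N k = ⋂ j, {x | dot x (N j) ≤ k j} := by ext; simp [PolyDelta]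
  rw [this]
  exact isClosed_iInter fun j => isClosed_le (dot_cont _) continuous_const

lemma poly_compact {n m : ℕ} (N : Fin m → Fin n → ℝ) (k0 : Fin m → ℝ)
    (hcpt : IsCompact (PolyDelta N k0)) (hne : (PolyDelta N k0).Nonempty)
    (hD : IsDelzant N k0) (k : Fin m → ℝ) : IsCompact (PolyDelta N k) := by
  have hb : ∀ c : Fin n → ℝ, ∃ M, ∀ x ∈ PolyDelta N k, dot x c ≤ M := by
    intro c
    obtain ⟨e, he, l, hl, hc⟩ := cover N k0 hcpt hne hD c
    refine ⟨∑ i, l i * k (e i), fun x hx => ?_⟩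
    rw [hc, dot_sum_right]
    refine Finset.sum_le_sum fun i _ => ?_
    rw [dot_smul_right]
    exact mul_le_mul_of_nonneg_left (hx _) (hl i)
  choose M hM using hb
  refine (isCompact_Icc (a := fun i => - M (-Pi.single i 1))
    (b := fun i => M (Pi.single i 1))).of_isClosed_subset (poly_closed N k) ?_
  intro x hx
  refine ⟨fun i => ?_, fun i => ?_⟩
  · have := hM (-Pi.single i 1) x hx
    simp [dot, Pi.single_apply] at this
    simp; linarith
  · have := hM (Pi.single i 1) x hx
    simpa [dot, Pi.single_apply] using this

lemma poly_vol_pos {n m : ℕ} (N : Fin m → Fin n → ℝ) (k0 : Fin m → ℝ)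
    (hcpt : IsCompact (PolyDelta N k0)) (hne : (PolyDelta N k0).Nonempty)
    (hD : IsDelzant N k0) (k : Fin m → ℝ) (hk : k ∈ UU N k0) :
    0 < volume (PolyDelta N k) := by
  obtain ⟨e, he, -⟩ := cover N k0 hcpt hne hD 0
  have hc : Continuous (fun t : ℝ => k - t • (1 : Fin m → ℝ)) := by fun_prop
  have hev : ∀ᶠ t : ℝ in nhds 0, k - t • (1 : Fin m → ℝ) ∈ UU N k0 :=
    (hc.tendsto 0).eventually ((UU_open N k0).mem_nhds (by simpa using hk))
  obtain ⟨t, ht, htp⟩ := ((hev.filter_mono nhdsWithin_le_nhds).and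
    (self_mem_nhdsWithin (s := Set.Ioi (0:ℝ)))).exists
  have htp : 0 < t := htp
  have hmem := vtx_mem ht he
  have hopen : IsOpen {x : Fin n → ℝ | ∀ j, dot x (N j) < k j} := by
    have : {x : Fin n → ℝ | ∀ j, dot x (N j) < k j} = ⋂ j, {x | dot x (N j) < k j} := by
      ext; simp
    rw [this]
    exact isOpen_iInter_of_finite fun j => isOpen_lt (dot_cont _) continuous_const
  refine lt_of_lt_of_le (hopen.measure_pos volume
    ⟨vtx N e (k - t • (1 : Fin m → ℝ)), fun j => ?_⟩)
    (measure_mono fun x hx j => (hx j).le)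
  · have := hmem j
    simp at this
    linarith

open scoped Pointwise in
lemma Cm_smul {n : ℕ} (K : Set (Fin n → ℝ)) (t : ℝ) (ht : 0 < t) :
    Cm ((fun x : Fin n → ℝ => t⁻¹ • x) ⁻¹' K) = t • Cm K := by
  have hpre : ((fun x : Fin n → ℝ => t⁻¹ • x) ⁻¹' K) = t • K := by
    exact Set.preimage_smul_inv₀ ht.ne' K
  rw [hpre]
  have h1 := Measure.setIntegral_comp_smul_of_pos (volume : Measure (Fin n → ℝ))
    (fun _ => (1:ℝ)) K ht
  have h2 := Measure.setIntegral_comp_smul_of_pos (volume : Measure (Fin n → ℝ))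
    (fun x => x) K ht
  rw [integral_smul] at h2
  set d := (t ^ Module.finrank ℝ (Fin n → ℝ)) with hd
  have hd0 : d ≠ 0 := (pow_pos ht _).ne'
  have h1' : ∫ x in t • K, (1:ℝ) = d * ∫ x in K, (1:ℝ) := by
    rw [h1, smul_eq_mul]; field_simp
  have h2' : ∫ x in t • K, x = d • t • ∫ x in K, x := by
    rw [h2, smul_smul, mul_inv_cancel₀ hd0, one_smul]
  unfold Cm
  rw [h1', h2', smul_smul, smul_smul, smul_smul]
  congr 1
  rw [mul_inv]
  field_simp

lemma Cm_add {n : ℕ} (K : Set (Fin n → ℝ)) (hK : IsCompact K) (hpos : 0 < volume K)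
    (v : Fin n → ℝ) :
    Cm ((fun x : Fin n → ℝ => x + v) ⁻¹' K) = Cm K - v := by
  have hmp := measurePreserving_add_right (volume : Measure (Fin n → ℝ)) v
  have hemb := measurableEmbedding_addRight v
  have h1 := hmp.setIntegral_preimage_emb hemb (fun _ => (1:ℝ)) K
  have h2 := hmp.setIntegral_preimage_emb hemb (fun x => x - v) K
  simp only [add_sub_cancel_right] at h2
  have hfin : volume K ≠ ⊤ := hK.measure_lt_top.ne
  have hi1 : IntegrableOn (fun x : Fin n → ℝ => x) K :=
    continuous_id.continuousOn.integrableOn_compact hK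
  have hi2 : IntegrableOn (fun _ : Fin n → ℝ => v) K :=
    continuous_const.continuousOn.integrableOn_compact hK
  rw [integral_sub hi1 hi2] at h2
  have hne : (∫ x in K, (1:ℝ)) ≠ 0 := by
    simp [Measure.real, ENNReal.toReal_eq_zero_iff, hpos.ne', hfin]
  have h3 : ∫ x in K, v = (∫ x in K, (1:ℝ)) • v := by
    simp
  unfold Cm
  rw [h1, h2, h3, smul_sub, smul_smul, inv_mul_cancel₀ hne, one_smul]

lemma poly_smul {n m : ℕ} (N : Fin m → Fin n → ℝ) (k : Fin m → ℝ) (t : ℝ) (ht : 0 < t) :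
    PolyDelta N (t • k) = (fun x : Fin n → ℝ => t⁻¹ • x) ⁻¹' PolyDelta N k := by
  ext x
  simp only [PolyDelta, Set.mem_setOf_eq, Set.mem_preimage, dot_smul_left, Pi.smul_apply,
    smul_eq_mul]
  refine forall_congr' fun j => ?_
  rw [inv_mul_le_iff₀ ht]

lemma poly_add {n m : ℕ} (N : Fin m → Fin n → ℝ) (k : Fin m → ℝ) (v : Fin n → ℝ) :
    PolyDelta N (k + fun j => dot v (N j)) = (fun x : Fin n → ℝ => x + (-v)) ⁻¹' PolyDelta N k := by
  ext x
  simp only [PolyDelta, Set.mem_setOf_eq, Set.mem_preimage, dot_add_left, Pi.add_apply]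
  refine forall_congr' fun j => ?_
  have : dot (-v) (N j) = - dot v (N j) := by simp [dot]
  rw [this]
  constructor <;> intro h <;> linarith

/-- Codimension at most one. -/
lemma exists_phi {n m : ℕ} (S : ((Fin n → ℝ) × ℝ) →ₗ[ℝ] (Fin m → ℝ))
    (hS : Function.Injective S) (hm : m ≤ n + 2) :
    ∃ (φ : (Fin m → ℝ) →ₗ[ℝ] ℝ) (y : Fin m → ℝ), ∀ x, ∃ p, S p = x - φ x • y := by
  by_cases h : LinearMap.range S = ⊤
  · refine ⟨0, 0, fun x => ?_⟩
    simpa using LinearMap.range_eq_top.1 h x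
  · obtain ⟨φ, hφ, hle⟩ := Submodule.exists_le_ker_of_lt_top _ (lt_top_iff_ne_top.2 h)
    have hk : LinearMap.ker φ ≠ ⊤ := fun h => hφ (LinearMap.ker_eq_top.1 h)
    have h1 := Submodule.finrank_lt hk
    have h2 := LinearMap.finrank_range_of_inj hS
    simp at h1 h2
    have heq : LinearMap.range S = LinearMap.ker φ :=
      Submodule.eq_of_le_of_finrank_le hle (by omega)
    obtain ⟨y, hy⟩ : ∃ y, φ y ≠ 0 := by
      by_contra hc; push Not at hc; exact hφ (LinearMap.ext hc)
    refine ⟨φ, (φ y)⁻¹ • y, fun x => ?_⟩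
    have : x - φ x • (φ y)⁻¹ • y ∈ LinearMap.range S := by
      rw [heq, LinearMap.mem_ker]
      simp [hy]
    exact this

/-- The analytic core. -/
lemma core {m : ℕ} (U : Set (Fin m → ℝ)) (hU : IsOpen U) (hconv : Convex ℝ U)
    (k0 : Fin m → ℝ) (hk0 : k0 ∈ U) (f : (Fin m → ℝ) → ℝ)
    (D : (Fin m → ℝ) → ((Fin m → ℝ) →L[ℝ] ℝ))
    (hD : ∀ k ∈ U, HasFDerivAt f (D k) k) (hDc : ContinuousOn D U)
    (heul : ∀ k ∈ U, D k k = f k)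
    (φ : (Fin m → ℝ) →ₗ[ℝ] ℝ) (y : Fin m → ℝ)
    (hφ : ∀ k ∈ U, ∀ k' ∈ U, ∀ x, D k x - D k' x = φ x * (D k y - D k' y)) :
    ∃ k1 ∈ U, ∀ k ∈ U, f k = D k1 k := by
  by_cases h0 : φ = 0
  · refine ⟨k0, hk0, fun k hk => ?_⟩
    have := hφ k hk k0 hk0 k
    rw [h0] at this
    simp at this
    rw [← heul k hk]; linarith
  obtain ⟨k1, hk1, hk1φ⟩ : ∃ k1 ∈ U, φ k1 ≠ 0 := by
    by_contra hc
    push Not at hc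
    apply h0
    ext1 i
    ext
    have hcont : Continuous (fun t : ℝ => k0 + t • (Pi.single i 1 : Fin m → ℝ)) := by fun_prop
    have hev : ∀ᶠ t : ℝ in nhds 0, k0 + t • (Pi.single i 1 : Fin m → ℝ) ∈ U :=
      (hcont.tendsto 0).eventually (hU.mem_nhds (by simpa using hk0))
    obtain ⟨t, ht, htp⟩ := ((hev.filter_mono nhdsWithin_le_nhds).and
      (self_mem_nhdsWithin (s := Set.Ioi (0:ℝ)))).exists
    have htp : 0 < t := htp
    have h1 := hc _ ht
    rw [map_add, hc _ hk0, map_smul, zero_add, smul_eq_mul] at h1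
    simpa [htp.ne'] using h1
  refine ⟨k1, hk1, fun k hk => ?_⟩
  set γ : ℝ → (Fin m → ℝ) := fun t => k1 + t • (k - k1) with hγ
  have hγU : ∀ t ∈ Set.Icc (0:ℝ) 1, γ t ∈ U := fun t ht => by
    have := hconv.add_smul_sub_mem hk1 hk ht
    exact this
  have hγd : ∀ t, HasDerivAt γ (k - k1) t := by
    intro t
    have := ((hasDerivAt_id t).smul_const (k - k1)).const_add k1
    rw [one_smul] at this
    exact this
  have hγc : Continuous γ := by fun_prop
  set β : ℝ → ℝ := fun t => D (γ t) y - D k1 y with hβ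
  have hβc : ContinuousOn β (Set.Icc 0 1) := by
    have h1 : ContinuousOn (fun t => D (γ t)) (Set.Icc 0 1) :=
      hDc.comp hγc.continuousOn hγU
    exact (h1.clm_apply continuousOn_const).sub continuousOn_const
  set p : ℝ → ℝ := fun t => φ (γ t) with hp
  have hpd : ∀ t, HasDerivAt p (φ (k - k1)) t := by
    intro t
    have := (LinearMap.toContinuousLinearMap φ).hasFDerivAt.comp_hasDerivAt t (hγd t)
    exact this
  set G : ℝ → ℝ := fun t => f (γ t) - D k1 (γ t) with hG
  have hGp : ∀ t ∈ Set.Icc (0:ℝ) 1, G t = p t * β t := by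
    intro t ht
    have := hφ _ (hγU t ht) k1 hk1 (γ t)
    rw [heul _ (hγU t ht)] at this
    exact this
  have hGd : ∀ t ∈ Set.Icc (0:ℝ) 1, HasDerivAt G (φ (k - k1) * β t) t := by
    intro t ht
    have h1 := (hD _ (hγU t ht)).comp_hasDerivAt t (hγd t)
    have h2 := (D k1).hasFDerivAt.comp_hasDerivAt t (hγd t)
    have h3 := h1.sub h2
    rw [hφ _ (hγU t ht) k1 hk1] at h3
    exact h3
  have hcount : {t : ℝ | p t = 0}.Countable := by
    apply Set.Subsingleton.countable
    intro s hs t ht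
    have hs : φ (k1 + s • (k - k1)) = 0 := hs
    have ht : φ (k1 + t • (k - k1)) = 0 := ht
    rw [map_add, map_smul, smul_eq_mul] at hs ht
    have hne : φ (k - k1) ≠ 0 := by
      intro h; rw [h] at hs; apply hk1φ; simpa using hs
    have : (s - t) * φ (k - k1) = 0 := by linarith
    rcases mul_eq_zero.1 this with h | h
    · linarith
    · exact absurd h hne
  have hβd : ∀ t ∈ Set.Ioo (0:ℝ) 1 \ {t : ℝ | p t = 0}, HasDerivAt β 0 t := by
    rintro t ⟨ht, hpt⟩
    have hpt : p t ≠ 0 := hpt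
    have htI := Set.Ioo_subset_Icc_self ht
    have h1 := (hGd t htI).div (hpd t) hpt
    have h2 : (φ (k - k1) * β t * p t - G t * φ (k - k1)) / p t ^ 2 = 0 := by
      rw [hGp t htI]; ring
    rw [h2] at h1
    refine h1.congr_of_eventuallyEq ?_
    have e1 : ∀ᶠ s in nhds t, s ∈ Set.Ioo (0:ℝ) 1 := isOpen_Ioo.mem_nhds ht
    have e2 : ∀ᶠ s in nhds t, p s ≠ 0 := (hpd t).continuousAt.eventually_ne hpt
    filter_upwards [e1, e2] with s hs hps
    rw [Pi.div_apply, hGp s (Set.Ioo_subset_Icc_self hs)]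
    field_simp
  have hint := MeasureTheory.integral_eq_of_hasDerivAt_off_countable_of_le β (fun _ => 0)
    zero_le_one hcount hβc hβd (by simp)
  simp only [intervalIntegral.integral_zero] at hint
  have hβ0 : β 0 = 0 := by simp [hβ, hγ]
  have hβ1 : β 1 = 0 := by linarith
  have hG1 := hGp 1 (by simp)
  rw [hβ1, mul_zero] at hG1
  simp only [hG, hγ, one_smul, add_sub_cancel] at hG1
  linarith

theorem stmt9 {n m : ℕ} (N : Fin m → Fin n → ℝ) (k0 : Fin m → ℝ)
    (hcpt : IsCompact (PolyDelta N k0)) (hint : (interior (PolyDelta N k0)).Nonempty)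
    (hDelzant : IsDelzant N k0) (hm1 : n + 1 ≤ m) (hm2 : m ≤ n + 2)
    (b : Fin n → ℤ) (f : (Fin m → ℝ) → ℝ)
    (hf : ∀ k, f k = dot (Cm (PolyDelta N k)) (fun i => (b i : ℝ)))
    (hC1 : ContDiffOn ℝ 1 f (chamber N k0))
    (hsum : ∀ k ∈ chamber N k0,
      (∑ j, fderivWithin ℝ f (chamber N k0) k (Pi.single j 1)) = 0) :
    ∃ R : Fin m → ℝ,
      (∀ k ∈ chamber N k0, f k = ∑ j, R j * k j) ∧ (∑ j, R j) = 0 := by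
  classical
  have hn : 0 < n := by
    rcases Nat.eq_zero_or_pos n with rfl | h
    · exfalso
      obtain ⟨z, -, hz⟩ := hDelzant.1 ⟨0, by omega⟩
      simp at hz
    · exact h
  have hne : (PolyDelta N k0).Nonempty := hint.mono interior_subset
  have hUeq := chamber_eq N k0 hcpt hne hDelzant hn
  rw [hUeq] at hC1 hsum ⊢
  have hU := UU_open N k0
  have hk0 := k0_mem_UU N k0
  have hD : ∀ k ∈ UU N k0, HasFDerivAt f (fderiv ℝ f k) k := fun k hk =>
    (((hC1.differentiableOn (by simp)) k hk).differentiableAt (hU.mem_nhds hk)).hasFDerivAt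
  have hDc : ContinuousOn (fderiv ℝ f) (UU N k0) := hC1.continuousOn_fderiv_of_isOpen hU le_rfl
  have hsum' : ∀ k ∈ UU N k0, fderiv ℝ f k 1 = 0 := by
    intro k hk
    have h := hsum k hk
    rw [fderivWithin_of_isOpen hU hk, ← map_sum, Finset.univ_sum_single (fun _ => (1:ℝ))] at h
    exact h
  -- Euler
  have heul : ∀ k ∈ UU N k0, fderiv ℝ f k k = f k := by
    intro k hk
    have hl : HasDerivAt (fun t : ℝ => t • k) k 1 := by
      simpa using (hasDerivAt_id (1:ℝ)).smul_const k
    have h1 : HasDerivAt (fun t : ℝ => f (t • k)) (fderiv ℝ f k k) 1 :=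
      HasFDerivAt.comp_hasDerivAt (1:ℝ) (by simpa using hD k hk) hl
    have h2 : HasDerivAt (fun t : ℝ => t * f k) (f k) 1 := by
      simpa using (hasDerivAt_id (1:ℝ)).mul_const (f k)
    refine h1.unique (h2.congr_of_eventuallyEq ?_)
    filter_upwards [lt_mem_nhds (zero_lt_one : (0:ℝ) < 1)] with t ht
    rw [hf, hf, poly_smul N k t ht, Cm_smul _ t ht, dot_smul_left]
  -- translations
  have htr : ∀ k ∈ UU N k0, ∀ v : Fin n → ℝ,
      fderiv ℝ f k (fun j => dot v (N j)) = dot v (fun i => (b i : ℝ)) := by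
    intro k hk v
    have hl : HasDerivAt (fun t : ℝ => k + t • (fun j => dot v (N j))) (fun j => dot v (N j)) 0 := by
      simpa using ((hasDerivAt_id (0:ℝ)).smul_const (fun j => dot v (N j))).const_add k
    have h1 : HasDerivAt (fun t : ℝ => f (k + t • (fun j => dot v (N j))))
        (fderiv ℝ f k (fun j => dot v (N j))) 0 :=
      HasFDerivAt.comp_hasDerivAt (0:ℝ) (by simpa using hD k hk) hl
    have h2 : HasDerivAt (fun t : ℝ => f k + t * dot v (fun i => (b i : ℝ)))
        (dot v (fun i => (b i : ℝ))) 0 := by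
      simpa using ((hasDerivAt_id (0:ℝ)).mul_const (dot v (fun i => (b i : ℝ)))).const_add (f k)
    refine h1.unique (h2.congr_of_eventuallyEq (Filter.Eventually.of_forall fun t => ?_))
    have e1 : (t • (fun j => dot v (N j)) : Fin m → ℝ) = fun j => dot (t • v) (N j) := by
      ext j; simp [dot_smul_left]
    show f (k + t • (fun j => dot v (N j))) = f k + t * dot v (fun i => (b i : ℝ))
    rw [hf, hf k, e1, poly_add, Cm_add _ (poly_compact N k0 hcpt hne hDelzant k)
      (poly_vol_pos N k0 hcpt hne hDelzant k hk), sub_neg_eq_add, dot_add_left, dot_smul_left]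
  -- the linear map
  let S : ((Fin n → ℝ) × ℝ) →ₗ[ℝ] (Fin m → ℝ) :=
    { toFun := fun p => (fun j => dot p.1 (N j)) + p.2 • (1 : Fin m → ℝ)
      map_add' := by
        intro p q; ext j
        simp [dot_add_left]; ring
      map_smul' := by
        intro t p; ext j
        simp [dot_smul_left]; ring }
  have hSapp : ∀ p, S p = (fun j => dot p.1 (N j)) + p.2 • (1 : Fin m → ℝ) := fun p => rfl
  have hself : ∀ x : Fin n → ℝ, dot x x = 0 → x = 0 := by
    intro x hx
    ext i
    have := (Finset.sum_eq_zero_iff_of_nonneg (fun i _ => mul_self_nonneg (x i))).1 hx i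
      (Finset.mem_univ i)
    simpa using this
  have hinj : Function.Injective S := by
    rw [← LinearMap.ker_eq_bot, LinearMap.ker_eq_bot']
    rintro ⟨v, s⟩ h
    have hj : ∀ j, dot v (N j) = -s := by
      intro j
      have := congrFun h j
      simp [hSapp] at this
      linarith
    -- choose a cone containing plus or minus v
    obtain ⟨e, -, l, hl, hc⟩ := cover N k0 hcpt hne hDelzant v
    obtain ⟨e', -, l', hl', hc'⟩ := cover N k0 hcpt hne hDelzant (-v)
    have h1 : dot v v = (∑ i, l i) * (-s) := by
      conv_lhs => rw [hc]
      rw [← hc, dot_comm', dot_comm']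
      conv_lhs => arg 2; rw [hc]
      rw [dot_sum_right, Finset.sum_mul]
      exact Finset.sum_congr rfl fun i _ => by rw [dot_smul_right, hj]
    have h2 : -dot v v = (∑ i, l' i) * (-s) := by
      have : -dot v v = dot v (-v) := by simp [dot]
      rw [this, hc', dot_sum_right, Finset.sum_mul]
      exact Finset.sum_congr rfl fun i _ => by rw [dot_smul_right, hj]
    have hp : 0 ≤ ∑ i, l i := Finset.sum_nonneg fun i _ => hl i
    have hp' : 0 ≤ ∑ i, l' i := Finset.sum_nonneg fun i _ => hl' i
    have hvv : 0 ≤ dot v v := Finset.sum_nonneg fun i _ => mul_self_nonneg _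
    have hv0 : v = 0 := by
      apply hself
      rcases le_total 0 s with h | h
      · nlinarith [mul_nonneg hp h]
      · nlinarith [mul_nonneg hp' (neg_nonneg.2 h)]
    have hs := hj ⟨0, by omega⟩
    rw [hv0] at hs
    simp [dot] at hs
    simp [hv0, hs]
  obtain ⟨φ, y, hφ⟩ := exists_phi S hinj hm2
  have hSD : ∀ k ∈ UU N k0, ∀ p, fderiv ℝ f k (S p) = dot p.1 (fun i => (b i : ℝ)) := by
    intro k hk p
    rw [hSapp, map_add, htr k hk, map_smul, hsum' k hk]; simp
  obtain ⟨k1, hk1, hlin⟩ := core (UU N k0) hU (UU_convex N k0) k0 hk0 f (fderiv ℝ f) hD hDc heul φ y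
    (by
      intro k hk k' hk' x
      obtain ⟨p, hp⟩ := hφ x
      have e1 := hSD k hk p
      have e2 := hSD k' hk' p
      rw [hp, map_sub, map_smul, smul_eq_mul] at e1 e2
      linarith)
  refine ⟨fun j => fderiv ℝ f k1 (Pi.single j 1), fun k hk => ?_, ?_⟩
  · rw [hlin k hk]
    conv_lhs => rw [← Finset.univ_sum_single k]
    rw [map_sum]
    refine Finset.sum_congr rfl fun j _ => ?_
    have : (Pi.single j (k j) : Fin m → ℝ) = k j • Pi.single j 1 := by
      rw [← Pi.single_smul]; simp
    rw [this, map_smul, smul_eq_mul, mul_comm]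
  · have h := hsum k1 hk1
    rw [fderivWithin_of_isOpen hU hk1] at h
    exact h
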